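/- Let f : ℝ^n → ℝ be continuously differentiable and 2π-periodic in each variable. Then f has at least n + 1 critical points that are pairwise distinct modulo the lattice (2πℤ)^n; i.e., viewed as a function on the n-torus, f has at least n + 1 critical points. -/

import Mathlib

open Real

/-- Square-zero elements of a commutative ring of characteristic two with nonzero product. -/
theorem exists_ring_sq_zero_prod_ne_zero (n : ℕ) :
    ∃ (R : Type) (_ : CommRing R) (ε : Fin n → R),
      (∀ x : R, x + x = 0) ∧ (∀ k, ε k * ε k = 0) ∧ ((List.finRange n).map ε).prod ≠ 0 := by
  classical
  let S : Set (Fin n →₀ ℕ) := Set.range fun k => Finsupp.single k 2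
  let I : Ideal (MvPolynomial (Fin n) (ZMod 2)) :=
    Ideal.span ((fun s => MvPolynomial.monomial s (1 : ZMod 2)) '' S)
  refine ⟨MvPolynomial (Fin n) (ZMod 2) ⧸ I, inferInstance,
    fun k => Ideal.Quotient.mk I (MvPolynomial.X k), ?_, ?_, ?_⟩
  · intro x
    obtain ⟨p, rfl⟩ := Ideal.Quotient.mk_surjective x
    rw [← map_add, CharTwo.add_self_eq_zero, map_zero]
  · intro k
    rw [← map_mul, Ideal.Quotient.eq_zero_iff_mem, ← pow_two, MvPolynomial.X_pow_eq_monomial]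
    exact Ideal.subset_span ⟨_, ⟨k, rfl⟩, rfl⟩
  · have h : ((List.finRange n).map fun k => Ideal.Quotient.mk I (MvPolynomial.X k)).prod
        = Ideal.Quotient.mk I (MvPolynomial.monomial (∑ k : Fin n, Finsupp.single k 1) 1) := by
      rw [MvPolynomial.monomial_sum_one, map_prod, ← List.ofFn_eq_map, List.prod_ofFn]
      rfl
    rw [h, Ne, Ideal.Quotient.eq_zero_iff_mem, MvPolynomial.mem_ideal_span_monomial_image]
    intro hmem
    obtain ⟨_, ⟨k, rfl⟩, hle⟩ := hmem (∑ k : Fin n, Finsupp.single k 1) (by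
      simp [MvPolynomial.mem_support_iff])
    have := hle k
    simp [Finsupp.finsetSum_apply, Finsupp.single_apply] at this

/-- In characteristic two, a trace does not see a perturbation of closed elements by exact ones. -/
theorem trace_prod_add_commutator {A M ι : Type*} [Ring A] [AddCommGroup M] (D : A)
    (hD : D * D = 0) (h2 : ∀ x : A, x + x = 0) (tr : A →+ M) (htr : ∀ x, tr (D * x) = tr (x * D))
    (β H : ι → A) (hβ : ∀ i, Commute D (β i)) (l : List ι) (X : A) (hX : Commute D X) :
    tr (X * (l.map fun i => β i + (D * H i + H i * D)).prod) = tr (X * (l.map β).prod) := by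
  induction l generalizing X with
  | nil => simp
  | cons i l ih =>
    have hneg : ∀ x : A, -x = x := fun x => neg_eq_of_add_eq_zero_left (h2 x)
    have hc : Commute D (D * H i + H i * D) := by
      simp only [Commute, SemiconjBy, mul_add, add_mul, ← mul_assoc, hD]
      simp [mul_assoc, hD]
    have hY : Commute D (l.map β).prod := Commute.list_prod_right _ _ (by simpa using fun i _ => hβ i)
    simp only [List.map_cons, List.prod_cons, ← mul_assoc]
    rw [ih _ (hX.mul_right ((hβ i).add_right hc)), mul_add, add_mul, map_add]
    convert add_zero _
    set Y := (l.map β).prod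
    have e : X * (D * H i + H i * D) * Y = D * (X * H i * Y) + (X * H i * Y) * D := by
      calc _ = (X * D) * H i * Y + X * H i * (D * Y) := by noncomm_ring
        _ = (D * X) * H i * Y + X * H i * (Y * D) := by rw [hX.eq, hY.eq]
        _ = _ := by noncomm_ring
    rw [e, map_add, htr, ← map_add, h2, map_zero]

theorem sum_mul_sum_self_eq_zero {A ι : Type*} [Ring A] (h2 : ∀ x : A, x + x = 0) (x : ι → A)
    (hx : ∀ i, x i * x i = 0) (hc : ∀ i j, Commute (x i) (x j)) (s : Finset ι) :
    (∑ i ∈ s, x i) * (∑ i ∈ s, x i) = 0 := by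
  classical
  induction s using Finset.induction_on with
  | empty => simp
  | insert a s ha ih =>
    have h : Commute (x a) (∑ i ∈ s, x i) := Commute.sum_right _ _ _ fun i _ => hc a i
    rw [Finset.sum_insert ha, mul_add, add_mul, add_mul, hx, ih, h.eq, zero_add, add_zero, h2]

section Grid

variable {n N : ℕ} [NeZero N] {R : Type*} [CommRing R]

/-- The step in direction `k` on the discrete torus, weighted by `c`. -/
def stepMatrix (c : R) (k : Fin n) : Matrix (Fin n → ZMod N) (Fin n → ZMod N) R :=
  fun v w => if w = v + Pi.single k 1 then c else 0

/-- The steps in direction `k` which wrap around the discrete torus, weighted by `c`. -/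
def wrapMatrix (c : R) (k : Fin n) : Matrix (Fin n → ZMod N) (Fin n → ZMod N) R :=
  fun v w => if w = v + Pi.single k 1 ∧ v k = -1 then c else 0

/-- The sum of the entries of a matrix along the diagonal translation. -/
def shiftedTrace : Matrix (Fin n → ZMod N) (Fin n → ZMod N) R →+ R where
  toFun X := ∑ v, X v (v + 1)
  map_zero' := by simp
  map_add' X Y := by simp [Finset.sum_add_distrib]

theorem stepMatrix_mul_apply (c : R) (k : Fin n) (X : Matrix (Fin n → ZMod N) (Fin n → ZMod N) R)
    (v w : Fin n → ZMod N) :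
    (stepMatrix c k * X : Matrix _ _ R) v w = c * X (v + Pi.single k 1) w := by
  simp [Matrix.mul_apply, stepMatrix]

theorem mul_stepMatrix_apply (c : R) (k : Fin n) (X : Matrix (Fin n → ZMod N) (Fin n → ZMod N) R)
    (v w : Fin n → ZMod N) :
    (X * stepMatrix c k : Matrix _ _ R) v w = X v (w - Pi.single k 1) * c := by
  simp [Matrix.mul_apply, stepMatrix, ← sub_eq_iff_eq_add]

theorem commute_stepMatrix (c d : R) (k l : Fin n) :
    Commute (stepMatrix (N := N) c k) (stepMatrix d l) := by
  ext v w
  rw [stepMatrix_mul_apply, mul_stepMatrix_apply]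
  simp only [stepMatrix, sub_eq_iff_eq_add, add_right_comm]
  split_ifs <;> ring

theorem stepMatrix_mul_self (c : R) (hc : c * c = 0) (k : Fin n) :
    stepMatrix (N := N) c k * stepMatrix c k = 0 := by
  ext v w
  rw [stepMatrix_mul_apply]
  simp [stepMatrix, hc]

theorem commute_stepMatrix_wrapMatrix (ε : Fin n → R) (hε : ∀ k, ε k * ε k = 0) (k l : Fin n) :
    Commute (stepMatrix (N := N) (ε k) k) (wrapMatrix (ε l) l) := by
  ext v w
  rw [stepMatrix_mul_apply, mul_stepMatrix_apply]
  rcases eq_or_ne k l with rfl | h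
  · simp [wrapMatrix, hε]
  · have : (v + Pi.single k 1 : Fin n → ZMod N) l = v l := by simp [h.symm]
    simp only [wrapMatrix, sub_eq_iff_eq_add, add_right_comm, this]
    split_ifs <;> ring

theorem shiftedTrace_mul_stepMatrix (c : R) (k : Fin n)
    (X : Matrix (Fin n → ZMod N) (Fin n → ZMod N) R) :
    shiftedTrace (stepMatrix c k * X) = shiftedTrace (X * stepMatrix c k) := by
  simp only [shiftedTrace, AddMonoidHom.coe_mk, ZeroHom.coe_mk, stepMatrix_mul_apply,
    mul_stepMatrix_apply]
  refine Fintype.sum_equiv (Equiv.addRight (Pi.single k 1)) _ _ fun v => ?_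
  simp only [Equiv.coe_addRight]
  rw [mul_comm]
  congr 2
  abel

theorem prod_wrapMatrix_apply (ε : Fin n → R) (l : List (Fin n)) (hl : l.Nodup)
    (v w : Fin n → ZMod N) :
    (l.map fun k => wrapMatrix (ε k) k).prod v w =
      if w = v + (l.map fun k => Pi.single k 1).sum ∧ ∀ k ∈ l, v k = -1
        then (l.map ε).prod else 0 := by
  induction l generalizing v w with
  | nil => simp [Matrix.one_apply, eq_comm]
  | cons k l ih =>
    rw [List.nodup_cons] at hl
    have hv : (∀ j ∈ l, (v + Pi.single k 1 : Fin n → ZMod N) j = -1) ↔ ∀ j ∈ l, v j = -1 := by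
      refine forall₂_congr fun j hj => ?_
      have : j ≠ k := by rintro rfl; exact hl.1 hj
      simp [this]
    simp only [List.map_cons, List.prod_cons, Matrix.mul_apply, ih hl.2, List.sum_cons]
    rw [Finset.sum_eq_single (v + Pi.single k 1)]
    · simp only [hv, wrapMatrix, add_assoc, List.forall_mem_cons]
      split_ifs <;> simp_all
    · intro u _ hu
      simp [wrapMatrix, hu]
    · simp

theorem shiftedTrace_prod_wrapMatrix (ε : Fin n → R) :
    shiftedTrace (N := N) ((List.finRange n).map fun k => wrapMatrix (ε k) k).prod =
      ((List.finRange n).map ε).prod := by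
  have h1 : ((List.finRange n).map fun k => (Pi.single k 1 : Fin n → ZMod N)).sum = 1 := by
    rw [← List.ofFn_eq_map, List.sum_ofFn]
    ext j
    simp [Finset.sum_apply, Pi.single_apply]
  simp only [shiftedTrace, AddMonoidHom.coe_mk, ZeroHom.coe_mk,
    prod_wrapMatrix_apply ε _ (List.nodup_finRange n), h1, true_and, List.mem_finRange,
    forall_const]
  rw [Finset.sum_eq_single (fun _ => -1)]
  · simp
  · intro v _ hv
    exact if_neg fun h => hv (funext h)
  · simp

/-- A combinatorial form of the nonvanishing of the top cup product of degree-one classes on the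
torus: `n` functions on the grid cannot be such that near every point one of them has no
variation other than the one of the lift of a coordinate. -/
theorem grid_torus_obstruction (n N : ℕ) [NeZero N] (H : Fin n → (Fin n → ZMod N) → ℤ)
    (good : Fin n → ℕ → (Fin n → ZMod N) → Prop)
    (hgood : ∀ i m v k, m < n → good i m v →
      H i (v + Pi.single k 1) = H i v - if k = i ∧ v i = -1 then 1 else 0)
    (hstep : ∀ i m v k, m < n → good i m v → good i (m + 1) (v + Pi.single k 1))
    (hcov : ∀ v, ∃ i, good i 0 v) : False := by
  obtain ⟨R, _, ε, h2, hε, hprod⟩ := exists_ring_sq_zero_prod_ne_zero n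
  have h2' (x : Matrix (Fin n → ZMod N) (Fin n → ZMod N) R) : x + x = 0 := by
    ext; exact h2 _
  set D : Matrix (Fin n → ZMod N) (Fin n → ZMod N) R := ∑ k, stepMatrix (ε k) k with hDdef
  have hD : D * D = 0 := sum_mul_sum_self_eq_zero h2' _
    (fun k => stepMatrix_mul_self _ (hε k) k) (fun k l => commute_stepMatrix _ _ _ _) _
  let dg : Fin n → Matrix (Fin n → ZMod N) (Fin n → ZMod N) R :=
    fun i => Matrix.diagonal fun v => (H i v : R)
  let b : Fin n → Matrix (Fin n → ZMod N) (Fin n → ZMod N) R :=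
    fun i => wrapMatrix (ε i) i + (D * dg i + dg i * D)
  have hb (i : Fin n) (v w : Fin n → ZMod N) :
      b i v w = ∑ k, if w = v + Pi.single k 1 then
        ε k * ((if k = i ∧ v i = -1 then 1 else 0) + (H i (v + Pi.single k 1) + H i v : R))
        else 0 := by
    have h1 : wrapMatrix (ε i) i v w = ∑ k, if w = v + Pi.single k 1 then
        ε k * (if k = i ∧ v i = -1 then 1 else 0) else 0 := by
      rw [Finset.sum_eq_single i]
      · simp only [wrapMatrix, true_and, mul_ite, mul_one, mul_zero, ite_and]
      · intro k _ hk
        simp [hk]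
      · simp
    simp only [b, Matrix.add_apply, h1, dg, Matrix.mul_diagonal, Matrix.diagonal_mul, hDdef,
      Matrix.sum_apply, Finset.sum_mul, Finset.mul_sum, ← Finset.sum_add_distrib]
    refine Finset.sum_congr rfl fun k _ => ?_
    simp only [stepMatrix]
    split_ifs with h h'
    all_goals first | (subst h; ring) | ring
  have hvan (i : Fin n) (l : List (Fin n)) (m : ℕ) (v : Fin n → ZMod N) (hi : i ∈ l)
      (hm : m + l.length ≤ n) (hv : good i m v) (w : Fin n → ZMod N) :
      (l.map b).prod v w = 0 := by
    induction l generalizing m v with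
    | nil => simp at hi
    | cons j l ih =>
      rw [List.length_cons] at hm
      rw [List.map_cons, List.prod_cons, Matrix.mul_apply]
      refine Finset.sum_eq_zero fun u _ => ?_
      rw [hb, Finset.sum_mul]
      refine Finset.sum_eq_zero fun k _ => ?_
      by_cases hu : u = v + Pi.single k 1
      · subst hu
        rw [if_pos rfl]
        rcases List.mem_cons.1 hi with rfl | hi
        · rw [hgood i m v k (by omega) hv]
          convert zero_mul _
          convert mul_zero _
          push_cast
          split_ifs
          · linear_combination h2 (H i v : R)
          · linear_combination h2 (H i v : R)
        · rw [ih (m + 1) _ hi (by omega) (hstep i m v k (by omega) hv), mul_zero]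
      · rw [if_neg hu]
        exact zero_mul _
  have hzero : ((List.finRange n).map b).prod = 0 := by
    ext v w
    obtain ⟨i, hi⟩ := hcov v
    exact hvan i _ 0 v (List.mem_finRange i) (by simp) hi w
  have key := trace_prod_add_commutator D hD h2' shiftedTrace
    (fun X => by
      rw [hDdef, Finset.sum_mul, Finset.mul_sum, map_sum, map_sum]
      exact Finset.sum_congr rfl fun k _ => shiftedTrace_mul_stepMatrix _ _ _)
    (fun i => wrapMatrix (ε i) i) dg
    (fun i => Commute.sum_left _ _ _ fun k _ => commute_stepMatrix_wrapMatrix ε hε k i)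
    (List.finRange n) 1 (Commute.one_right _)
  rw [one_mul, one_mul, shiftedTrace_prod_wrapMatrix] at key
  refine hprod (key.symm.trans ?_)
  rw [show (fun i => wrapMatrix (ε i) i + (D * dg i + dg i * D)) = b from rfl, hzero, map_zero]

end Grid

/-- The vector of the period lattice `(2πℤ)^n` with integer coordinates `k`. -/
noncomputable def latticeVec {n : ℕ} (k : Fin n → ℤ) : Fin n → ℝ := fun l => 2 * π * (k l : ℝ)

theorem latticeVec_add {n : ℕ} (k m : Fin n → ℤ) :
    latticeVec (k + m) = latticeVec k + latticeVec m := by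
  ext l; simp [latticeVec, mul_add]

theorem latticeVec_neg {n : ℕ} (k : Fin n → ℤ) : latticeVec (-k) = -latticeVec k := by
  ext l; simp [latticeVec]

theorem two_pi_le_norm_latticeVec {n : ℕ} {k : Fin n → ℤ} (hk : k ≠ 0) :
    2 * π ≤ ‖latticeVec k‖ := by
  obtain ⟨l, hl⟩ := Function.ne_iff.1 hk
  refine le_trans ?_ (norm_le_pi_norm _ l)
  have h1 : (1 : ℝ) ≤ |(k l : ℝ)| := by
    rw [← Int.cast_abs]; exact_mod_cast Int.one_le_abs hl
  rw [latticeVec, Real.norm_eq_abs, abs_mul, abs_of_pos two_pi_pos]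
  nlinarith [two_pi_pos]

theorem exists_add_latticeVec_mem_Icc {n : ℕ} (x : Fin n → ℝ) :
    ∃ k : Fin n → ℤ, x + latticeVec k ∈ Set.Icc (0 : Fin n → ℝ) (fun _ => 2 * π) := by
  refine ⟨fun l => -⌊x l / (2 * π)⌋, fun l => ?_, fun l => ?_⟩
  · have := (le_div_iff₀ two_pi_pos).1 (Int.floor_le (x l / (2 * π)))
    simp only [latticeVec, Pi.add_apply, Pi.zero_apply, Int.cast_neg]
    linarith
  · have := (div_lt_iff₀ two_pi_pos).1 (Int.lt_floor_add_one (x l / (2 * π)))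
    simp only [latticeVec, Pi.add_apply, Int.cast_neg]
    linarith

/-- The point of the fundamental cube attached to a vertex of the discrete torus. -/
noncomputable def gridPoint {n N : ℕ} (v : Fin n → ZMod N) : Fin n → ℝ := fun l => 2 * π / N * (v l).val

theorem gridPoint_mem_Icc {n N : ℕ} [NeZero N] (v : Fin n → ZMod N) :
    gridPoint v ∈ Set.Icc (0 : Fin n → ℝ) (fun _ => 2 * π) := by
  have hN : (0 : ℝ) < N := Nat.cast_pos.2 (NeZero.pos N)
  refine ⟨fun l => ?_, fun l => ?_⟩
  · simp only [gridPoint, Pi.zero_apply]; positivity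
  · have : ((v l).val : ℝ) ≤ N := by exact_mod_cast (ZMod.val_lt (v l)).le
    simp only [gridPoint]
    rw [div_mul_eq_mul_div, div_le_iff₀ hN]
    exact mul_le_mul_of_nonneg_left this two_pi_pos.le

theorem gridPoint_add_single {n N : ℕ} [NeZero N] (v : Fin n → ZMod N) (k : Fin n) :
    gridPoint (v + Pi.single k 1) = gridPoint v + Pi.single k (2 * π / N) +
      latticeVec (-fun i => if k = i ∧ v i = -1 then 1 else 0) := by
  obtain ⟨M, rfl⟩ := Nat.exists_eq_succ_of_ne_zero (NeZero.ne N)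
  ext l
  rcases eq_or_ne k l with rfl | hkl
  · by_cases hv : v k = -1
    · simp only [gridPoint, Pi.add_apply, Pi.single_eq_same, hv, ZMod.val_neg_one, latticeVec,
        Pi.neg_apply]
      simp
      field_simp
      ring
    · have hlt : (v k).val + 1 < M + 1 := by
        have h1 := ZMod.val_lt (v k)
        rcases Nat.lt_or_ge ((v k).val + 1) (M + 1) with h | h
        · exact h
        · exact absurd (ZMod.val_injective _ (by rw [ZMod.val_neg_one]; omega)) hv
      have h1 : (1 : ZMod (M + 1)).val = 1 := ZMod.val_one'' (by omega)
      have h2 : (v k + 1).val = (v k).val + 1 := by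
        rw [ZMod.val_add_of_lt (by rw [h1]; exact hlt), h1]
      simp only [gridPoint, Pi.add_apply, Pi.single_eq_same, h2, latticeVec, Pi.neg_apply, hv]
      simp
      ring
  · simp [gridPoint, latticeVec, hkl, hkl.symm]

/-- A Lebesgue covering theorem for the torus: it is not covered by `n` open sets whose preimages
in `ℝ^n` split into disjoint open sets permuted simply transitively by the period lattice. -/
theorem torus_cover_obstruction {n : ℕ} (U : Fin n → (Fin n → ℤ) → Set (Fin n → ℝ))
    (hopen : ∀ i k, IsOpen (U i k)) (hcover : ∀ x, ∃ i k, x ∈ U i k)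
    (htrans : ∀ i k m x, x ∈ U i k → x + latticeVec m ∈ U i (k + m))
    (hdisj : ∀ i k k' x, x ∈ U i k → x ∈ U i k' → k = k') : False := by
  classical
  obtain ⟨δ, hδ, hball⟩ := lebesgue_number_lemma_of_metric
    (c := fun p : Fin n × (Fin n → ℤ) => U p.1 p.2)
    (isCompact_Icc (a := (0 : Fin n → ℝ)) (b := fun _ => 2 * π)) (fun p => hopen p.1 p.2)
    (fun x _ => by obtain ⟨i, k, h⟩ := hcover x; exact Set.mem_iUnion.2 ⟨(i, k), h⟩)
  obtain ⟨M, hM⟩ := exists_nat_gt (2 * π * n / δ)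
  set N := M + 1 with hN
  have hNpos : (0 : ℝ) < N := by positivity
  set h : ℝ := 2 * π / N with hh
  have hpos : 0 < h := by positivity
  have hsmall : n * h < δ := by
    rw [div_lt_iff₀ hδ] at hM
    rw [hh, mul_div_assoc', div_lt_iff₀ hNpos, hN]
    push_cast
    nlinarith
  have hradius (m : ℕ) (hm : m ≤ n) : 0 < δ - m * h := by
    have : (m : ℝ) ≤ n := by exact_mod_cast hm
    nlinarith
  let H : Fin n → (Fin n → ZMod N) → ℤ := fun i v =>
    if hx : ∃ k, gridPoint v ∈ U i k then hx.choose i else 0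
  have hH (i : Fin n) (v : Fin n → ZMod N) (k : Fin n → ℤ) (hk : gridPoint v ∈ U i k) :
      H i v = k i := by
    have hx : ∃ k, gridPoint v ∈ U i k := ⟨k, hk⟩
    simp only [H, dif_pos hx, hdisj i _ _ _ hx.choose_spec hk]
  have hnorm (k : Fin n) : ‖(Pi.single k h : Fin n → ℝ)‖ = h := by
    rw [Pi.norm_single, Real.norm_of_nonneg hpos.le]
  have hmove (i : Fin n) (m : ℕ) (v : Fin n → ZMod N) (k : Fin n) (κ : Fin n → ℤ)
      (hκ : Metric.ball (gridPoint v) (δ - m * h) ⊆ U i κ) :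
      Metric.ball (gridPoint (v + Pi.single k 1)) (δ - (m + 1 : ℕ) * h) ⊆
        U i (κ + -fun i => if k = i ∧ v i = -1 then 1 else 0) := by
    intro y hy
    rw [gridPoint_add_single, Metric.mem_ball, dist_eq_norm] at hy
    set ℓ : Fin n → ℤ := -fun i => if k = i ∧ v i = -1 then 1 else 0
    have hy' : y - latticeVec ℓ ∈ U i κ := by
      apply hκ
      rw [Metric.mem_ball, dist_eq_norm]
      have e : y - latticeVec ℓ - gridPoint v =
          (y - (gridPoint v + Pi.single k h + latticeVec ℓ)) + Pi.single k h := by abel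
      rw [e]
      refine (norm_add_le _ _).trans_lt ?_
      rw [hnorm]
      push_cast at hy
      linarith
    simpa using htrans i κ ℓ _ hy'
  refine grid_torus_obstruction n N H
    (fun i m v => ∃ κ, Metric.ball (gridPoint v) (δ - m * h) ⊆ U i κ) ?_ ?_ ?_
  · rintro i m v k hm ⟨κ, hκ⟩
    rw [hH i v κ (hκ (Metric.mem_ball_self (hradius m hm.le))),
      hH i _ (κ + -fun i => if k = i ∧ v i = -1 then 1 else 0)]
    · simp [sub_eq_add_neg]
    · refine hmove i m v k κ hκ (Metric.mem_ball_self (hradius (m + 1) hm))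
  · rintro i m v k hm ⟨κ, hκ⟩
    exact ⟨_, hmove i m v k κ hκ⟩
  · intro v
    obtain ⟨⟨i, κ⟩, hκ⟩ := hball _ (gridPoint_mem_Icc v)
    exact ⟨i, κ, by simpa using hκ⟩

/-- The vector of partial derivatives. -/
noncomputable def partials {n : ℕ} (f : (Fin n → ℝ) → ℝ) (x : Fin n → ℝ) : Fin n → ℝ :=
  fun j => fderiv ℝ f x (Pi.single j 1)

section Analysis

variable {n : ℕ} {f : (Fin n → ℝ) → ℝ}

theorem fderiv_apply_eq_sum_partials (x v : Fin n → ℝ) :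
    fderiv ℝ f x v = ∑ j, v j * partials f x j := by
  conv_lhs => rw [pi_eq_sum_univ' v]
  simp [partials]

theorem partials_eq_zero_iff (x : Fin n → ℝ) : partials f x = 0 ↔ fderiv ℝ f x = 0 := by
  refine ⟨fun h => ?_, fun h => ?_⟩
  · ext v
    simp [fderiv_apply_eq_sum_partials, h]
  · ext j
    simp [partials, h]

theorem continuous_partials (hf : ContDiff ℝ 1 f) : Continuous (partials f) :=
  continuous_pi fun _ => (hf.continuous_fderiv one_ne_zero).clm_apply continuous_const

theorem apply_add_latticeVec
    (hper : ∀ (x : Fin n → ℝ) (j : Fin n), f (x + Pi.single j (2 * π)) = f x)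
    (x : Fin n → ℝ) (k : Fin n → ℤ) : f (x + latticeVec k) = f x := by
  have h1 (j : Fin n) : Function.Periodic f (Pi.single j (2 * π)) := fun x => hper x j
  have h2 (s : Finset (Fin n)) :
      Function.Periodic f (∑ j ∈ s, k j • (Pi.single j (2 * π) : Fin n → ℝ)) := by
    classical
    induction s using Finset.induction_on with
    | empty => intro x; simp
    | insert a s ha ih =>
      rw [Finset.sum_insert ha]
      exact ((h1 a).zsmul (k a)).add_period ih
  have h3 : latticeVec k = ∑ j, k j • (Pi.single j (2 * π) : Fin n → ℝ) := by
    ext l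
    simp [latticeVec, Finset.sum_apply, Pi.single_apply, mul_comm]
  rw [h3]
  exact h2 _ x

theorem fderiv_add_latticeVec (hper : ∀ x k, f (x + latticeVec k) = f x)
    (x : Fin n → ℝ) (k : Fin n → ℤ) : fderiv ℝ f (x + latticeVec k) = fderiv ℝ f x := by
  rw [← fderiv_comp_add_right]
  simp only [hper]

theorem partials_add_latticeVec (hper : ∀ x k, f (x + latticeVec k) = f x)
    (x : Fin n → ℝ) (k : Fin n → ℤ) : partials f (x + latticeVec k) = partials f x := by
  ext j
  simp only [partials, fderiv_add_latticeVec hper]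

theorem exists_dist_fderiv_lt (hf : ContDiff ℝ 1 f) (hper : ∀ x k, f (x + latticeVec k) = f x)
    {c : ℝ} (hc : 0 < c) :
    ∃ δ > 0, ∀ x y, dist x y < δ → dist (fderiv ℝ f x) (fderiv ℝ f y) < c := by
  have := (isCompact_Icc (a := (0 : Fin n → ℝ)) (b := fun _ => 2 * π)).uniformContinuousAt_of_continuousAt
    (fderiv ℝ f) (fun a _ => (hf.continuous_fderiv one_ne_zero).continuousAt)
    (Metric.dist_mem_uniformity hc)
  obtain ⟨δ, hδ, h⟩ := Metric.mem_uniformity_dist.1 this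
  refine ⟨δ, hδ, fun x y hxy => ?_⟩
  obtain ⟨k, hk⟩ := exists_add_latticeVec_mem_Icc x
  have := h (a := x + latticeVec k) (b := y + latticeVec k) (by rwa [dist_add_right]) hk
  simpa [fderiv_add_latticeVec hper] using this

theorem exists_norm_partials_le (hf : ContDiff ℝ 1 f)
    (hper : ∀ x k, f (x + latticeVec k) = f x) : ∃ M, ∀ x, ‖partials f x‖ ≤ M := by
  obtain ⟨M, hM⟩ := (isCompact_Icc (a := (0 : Fin n → ℝ)) (b := fun _ => 2 * π)).exists_bound_of_continuousOn
    (continuous_partials hf).continuousOn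
  refine ⟨M, fun x => ?_⟩
  obtain ⟨k, hk⟩ := exists_add_latticeVec_mem_Icc x
  simpa [partials_add_latticeVec hper] using hM _ hk

theorem exists_le_apply (hf : Continuous f) (hper : ∀ x k, f (x + latticeVec k) = f x) :
    ∃ x₀, ∀ x, f x₀ ≤ f x := by
  obtain ⟨x₀, -, h⟩ := (isCompact_Icc (a := (0 : Fin n → ℝ)) (b := fun _ => 2 * π)).exists_isMinOn
    ⟨0, le_rfl, fun _ => two_pi_pos.le⟩ hf.continuousOn
  refine ⟨x₀, fun x => ?_⟩
  obtain ⟨k, hk⟩ := exists_add_latticeVec_mem_Icc x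
  simpa [hper] using h hk

/-- Away from its zeros, the derivative of a periodic function is bounded below. -/
theorem exists_le_norm_partials (hf : ContDiff ℝ 1 f)
    (hper : ∀ x k, f (x + latticeVec k) = f x) {r : ℝ} (hr : 0 < r) :
    ∃ μ > 0, ∀ x, (∀ q, fderiv ℝ f q = 0 → r ≤ dist x q) → μ ≤ ‖partials f x‖ := by
  let S : Set (Fin n → ℝ) := ⋃ q ∈ {q | fderiv ℝ f q = 0}, Metric.ball q r
  have hS : IsOpen S := isOpen_biUnion fun _ _ => Metric.isOpen_ball
  obtain ⟨μ, hμ, h⟩ := ((isCompact_Icc (a := (0 : Fin n → ℝ)) (b := fun _ => 2 * π)).diff hS).exists_forall_le'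
    (continuous_partials hf).norm.continuousOn (a := 0) (fun x hx => by
      rw [norm_pos_iff, Ne, partials_eq_zero_iff]
      exact fun h0 => hx.2 (Set.mem_biUnion (show x ∈ {q | fderiv ℝ f q = 0} from h0)
        (Metric.mem_ball_self hr)))
  refine ⟨μ, hμ, fun x hx => ?_⟩
  obtain ⟨k, hk⟩ := exists_add_latticeVec_mem_Icc x
  rw [← partials_add_latticeVec hper x k]
  refine h _ ⟨hk, fun hmem => ?_⟩
  obtain ⟨q, hq, hxq⟩ := Set.mem_iUnion₂.1 hmem
  have h1 := hx (q + latticeVec (-k)) ((fderiv_add_latticeVec hper q (-k)).trans hq)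
  rw [latticeVec_neg, ← dist_add_right _ _ (latticeVec k), neg_add_cancel_right] at h1
  exact absurd hxq (not_lt.2 h1)

/-- One step of a discretised gradient descent for a periodic function. -/
theorem exists_descent_step (hf : ContDiff ℝ 1 f) (hper : ∀ x k, f (x + latticeVec k) = f x)
    {c ρ : ℝ} (hc : 0 < c) (hρ : 0 < ρ) :
    ∃ (g : (Fin n → ℝ) → Fin n → ℝ) (τ : ℝ), 0 < τ ∧ Continuous g ∧
      (∀ x k, g (x + latticeVec k) = g x + latticeVec k) ∧
      (∀ x, dist (g x) x ≤ ρ) ∧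
      (∀ x, f (g x) ≤ f x - ‖partials f x‖ / 2 * dist (g x) x) ∧
      (∀ x, 2 * c ≤ ‖partials f x‖ → τ ≤ dist (g x) x) := by
  obtain ⟨δ, hδ, hδf⟩ := exists_dist_fderiv_lt hf hper (half_pos hc)
  obtain ⟨M, hM⟩ := exists_norm_partials_le hf hper
  obtain ⟨h, hh, hh1⟩ : ∃ h > 0, h * (M * M) ≤ min (δ / 2) ρ := by
    have : 0 < min (δ / 2) ρ := by positivity
    have hM1 : 0 < M * M + 1 := by nlinarith [mul_self_nonneg M]
    refine ⟨min (δ / 2) ρ / (M * M + 1), div_pos this hM1, ?_⟩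
    rw [div_mul_eq_mul_div, div_le_iff₀ hM1]
    nlinarith
  let m : (Fin n → ℝ) → ℝ := fun x => max 0 (‖partials f x‖ - c)
  let g : (Fin n → ℝ) → Fin n → ℝ := fun x => x - (h * m x) • partials f x
  have hm0 (x) : 0 ≤ m x := le_max_left _ _
  have hdist (x) : dist (g x) x = h * m x * ‖partials f x‖ := by
    rw [dist_eq_norm, sub_sub_cancel_left, norm_neg, norm_smul,
      Real.norm_of_nonneg (mul_nonneg hh.le (hm0 x))]
  have hle (x) : dist (g x) x ≤ min (δ / 2) ρ := by
    rw [hdist]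
    refine le_trans ?_ hh1
    rw [mul_assoc]
    have h1 : m x ≤ M := max_le ((norm_nonneg _).trans (hM x)) (by linarith [hM x])
    gcongr
    · exact (norm_nonneg _).trans (hM x)
    · exact hM x
  refine ⟨g, h * c * (2 * c), by positivity, ?_, ?_, fun x => (hle x).trans (min_le_right _ _),
    ?_, ?_⟩
  · have := continuous_partials hf
    fun_prop
  · intro x k
    simp only [g, m, partials_add_latticeVec hper]
    abel
  · intro x
    have hmv := (convex_closedBall x (δ / 2)).norm_image_sub_le_of_norm_fderiv_le' (𝕜 := ℝ) (f := f)
      (φ := fderiv ℝ f x) (C := c / 2) (x := x) (y := g x)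
      (fun y _ => hf.differentiable one_ne_zero y)
      (fun y hy => by
        rw [← dist_eq_norm]
        exact (hδf y x ((Metric.mem_closedBall.1 hy).trans_lt (by linarith))).le)
      (Metric.mem_closedBall_self (by positivity))
      (Metric.mem_closedBall.2 ((hle x).trans (min_le_left _ _)))
    rw [← dist_eq_norm (g x), Real.norm_eq_abs] at hmv
    have h1 := (abs_le.1 hmv).2
    have h2 : fderiv ℝ f x (g x - x) = -(h * m x) * ∑ j, partials f x j * partials f x j := by
      rw [fderiv_apply_eq_sum_partials, Finset.mul_sum]
      refine Finset.sum_congr rfl fun j _ => ?_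
      simp [g]
      ring
    have h3 : ‖partials f x‖ * ‖partials f x‖ ≤ ∑ j, partials f x j * partials f x j := by
      have h0 : 0 ≤ ∑ j, partials f x j * partials f x j :=
        Finset.sum_nonneg fun j _ => mul_self_nonneg _
      rw [← Real.mul_self_sqrt h0]
      refine mul_self_le_mul_self (norm_nonneg _) ?_
      refine (pi_norm_le_iff_of_nonneg (Real.sqrt_nonneg _)).2 fun j => Real.abs_le_sqrt ?_
      rw [sq]
      exact Finset.single_le_sum (f := fun j => partials f x j * partials f x j)
        (fun j _ => mul_self_nonneg _) (Finset.mem_univ j)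
    have h4 : 0 ≤ h * m x := mul_nonneg hh.le (hm0 x)
    have h5 : h * m x * (‖partials f x‖ * ‖partials f x‖) ≤
        h * m x * ∑ j, partials f x j * partials f x j := mul_le_mul_of_nonneg_left h3 h4
    have h6 : c * dist (g x) x ≤ ‖partials f x‖ * dist (g x) x := by
      rcases le_or_gt c ‖partials f x‖ with hcx | hcx
      · gcongr
      · simp [hdist, m, max_eq_left (sub_nonpos.2 hcx.le)]
    rw [hdist] at *
    nlinarith
  · intro x hx
    rw [hdist]
    have : c ≤ m x := le_max_of_le_right (by linarith)
    gcongr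

open Filter Topology in
/-- Critical points forming finitely many classes modulo the period lattice are uniformly
separated. -/
theorem exists_le_dist_of_fderiv_eq_zero {ι : Type*} [Finite ι]
    (hper : ∀ x k, f (x + latticeVec k) = f x) (p : ι → Fin n → ℝ)
    (hp : ∀ q, fderiv ℝ f q = 0 → ∃ i k, q = p i + latticeVec k) :
    ∃ r > 0, ∀ i k q, fderiv ℝ f q = 0 → q ≠ p i + latticeVec k →
      r ≤ dist q (p i + latticeVec k) := by
  have hfin (B : ℝ) : {k : Fin n → ℤ | ‖latticeVec k‖ ≤ B}.Finite := by
    refine (Set.finite_Icc (fun _ : Fin n => -⌈B⌉) fun _ => ⌈B⌉).subset fun k hk => ?_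
    have hl (l : Fin n) : |k l| ≤ ⌈B⌉ := by
      have h1 : |2 * π * (k l : ℝ)| ≤ B := (norm_le_pi_norm (latticeVec k) l).trans hk
      rw [abs_mul, abs_of_pos two_pi_pos] at h1
      have h2 : |(k l : ℝ)| ≤ ⌈B⌉ := by
        refine le_trans ?_ (Int.le_ceil B)
        nlinarith [abs_nonneg (k l : ℝ), pi_gt_three]
      exact_mod_cast h2
    exact ⟨fun l => (abs_le.1 (hl l)).1, fun l => (abs_le.1 (hl l)).2⟩
  have hloc (i : ι) : ∀ᶠ r in 𝓝[>] (0 : ℝ), ∀ q, fderiv ℝ f q = 0 → q ≠ p i →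
      r ≤ dist q (p i) := by
    let C : Set (Fin n → ℝ) := {q | fderiv ℝ f q = 0 ∧ dist q (p i) ≤ 1 ∧ q ≠ p i}
    have hC : C.Finite := by
      refine (Set.finite_iUnion fun j =>
        (hfin (1 + dist (p i) (p j))).image fun k => p j + latticeVec k).subset ?_
      rintro q ⟨hq, hq1, -⟩
      obtain ⟨j, k, rfl⟩ := hp q hq
      refine Set.mem_iUnion.2 ⟨j, k, ?_, rfl⟩
      have := dist_triangle (p j + latticeVec k) (p i) (p j)
      rw [dist_self_add_left] at this
      exact this.trans (by linarith)
    obtain ⟨e, he, hball⟩ := Metric.isOpen_iff.1 hC.isClosed.isOpen_compl (p i) fun h => h.2.2 rfl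
    filter_upwards [Ioc_mem_nhdsGT (lt_min he one_pos)] with r hr q hq hne
    by_contra! hlt
    have h1 := hlt.trans_le hr.2
    exact hball (Metric.mem_ball.2 (h1.trans_le (min_le_left _ _)))
      ⟨hq, (h1.trans_le (min_le_right _ _)).le, hne⟩
  obtain ⟨r, hr, hr0⟩ := ((eventually_all.2 hloc).and self_mem_nhdsWithin).exists
  refine ⟨r, hr0, fun i k q hq hne => ?_⟩
  have := hr i (q + latticeVec (-k)) ((fderiv_add_latticeVec hper q (-k)).trans hq) (by
    rw [latticeVec_neg]
    exact fun h => hne (by rw [← h]; abel))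
  rwa [← dist_add_right _ _ (latticeVec k), latticeVec_neg, neg_add_cancel_right] at this

open Filter Topology in
/-- The critical points of a periodic `C¹` function on `ℝ^n` form more than `n` classes modulo the
period lattice. -/
theorem exists_fderiv_eq_zero_ne_add_latticeVec (hf : ContDiff ℝ 1 f)
    (hper : ∀ x k, f (x + latticeVec k) = f x) (p : Fin n → Fin n → ℝ)
    (hp : ∀ i, fderiv ℝ f (p i) = 0) :
    ∃ q, fderiv ℝ f q = 0 ∧ ∀ i k, q ≠ p i + latticeVec k := by
  by_contra! hcrit
  obtain ⟨r, hr, hsep⟩ : ∃ r > 0, ∀ i k q, fderiv ℝ f q = 0 → q ≠ p i + latticeVec k →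
      3 * r ≤ dist q (p i + latticeVec k) := by
    obtain ⟨r, hr, h⟩ := exists_le_dist_of_fderiv_eq_zero hper p hcrit
    exact ⟨r / 3, by positivity, by simpa [mul_div_cancel₀] using h⟩
  obtain ⟨μ, hμ, hμf⟩ := exists_le_norm_partials hf hper (half_pos hr)
  obtain ⟨ε, hε, hεr, hεf⟩ : ∃ ε > 0, ε ≤ r ∧ ∀ i k x, dist x (p i + latticeVec k) < ε →
      |f x - f (p i)| < μ * r / 8 := by
    have h (i : Fin n) : ∀ᶠ ε in 𝓝[>] (0 : ℝ), ∀ x, dist x (p i) < ε →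
        |f x - f (p i)| < μ * r / 8 := by
      obtain ⟨e, he, h⟩ := Metric.continuous_iff.1 hf.continuous (p i) (μ * r / 8) (by positivity)
      filter_upwards [Ioc_mem_nhdsGT he] with ε hε x hx
      exact h x (hx.trans_le hε.2)
    obtain ⟨ε, hε, hε0⟩ := ((eventually_all.2 h).and (Ioc_mem_nhdsGT hr)).exists
    refine ⟨ε, hε0.1, hε0.2, fun i k x hx => ?_⟩
    have := hε i (x + latticeVec (-k)) (by
      rwa [← dist_add_right _ _ (latticeVec k), latticeVec_neg, neg_add_cancel_right])
    rwa [hper] at this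
  obtain ⟨c, hc, hcf⟩ := exists_le_norm_partials hf hper hε
  obtain ⟨g, τ, hτ, hgc, hgper, hgρ, hgf, hgτ⟩ :=
    exists_descent_step hf hper (half_pos hc) (half_pos hr)
  have hmono (x) : f (g x) ≤ f x :=
    (hgf x).trans (sub_le_self _ (by positivity))
  have hiter (t : ℕ) (x k) : g^[t] (x + latticeVec k) = g^[t] x + latticeVec k := by
    induction t generalizing x with
    | zero => rfl
    | succ t ih => rw [Function.iterate_succ_apply, hgper, ih, Function.iterate_succ_apply]
  -- A descending orbit visits the neighbourhood of at most one translate of each critical point.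
  have horbit (i : Fin n) (k k' : Fin n → ℤ) (y : Fin n → ℝ) (t : ℕ)
      (hy : dist y (p i + latticeVec k) < ε)
      (hy' : dist (g^[t] y) (p i + latticeVec k') < ε) : k = k' := by
    by_contra hkk
    set q := p i + latticeVec k with hq
    set q' := p i + latticeVec k' with hq'
    have hcr' : fderiv ℝ f q' = 0 := (fderiv_add_latticeVec hper _ _).trans (hp i)
    have hqq : 3 * r ≤ dist q' q := by
      refine hsep i k q' hcr' fun h => ?_
      have h1 := two_pi_le_norm_latticeVec (sub_ne_zero.2 hkk)
      rw [sub_eq_add_neg, latticeVec_add, latticeVec_neg, ← sub_eq_add_neg,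
        (add_left_cancel h : latticeVec k' = latticeVec k), sub_self, norm_zero] at h1
      exact absurd h1 (not_le.2 two_pi_pos)
    let u : (Fin n → ℝ) → ℝ := fun z => max r (min (2 * r) (dist z q))
    let F : (Fin n → ℝ) → ℝ := fun z => f z + μ / 2 * u z
    have hF (z) : F (g z) ≤ F z := by
      have h1 := hgρ z
      have h2 := dist_triangle (g z) z q
      have h3 := dist_triangle z (g z) q
      rw [dist_comm z (g z)] at h3
      have h4 := hmono z
      rcases lt_or_ge (dist z q) (r / 2) with hz | hz
      · have e1 : u z = r := max_eq_left ((min_le_right _ _).trans (by linarith))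
        have e2 : u (g z) = r := max_eq_left ((min_le_right _ _).trans (by linarith))
        simp only [F, e1, e2]
        linarith
      rcases lt_or_ge (5 * r / 2) (dist z q) with hz' | hz'
      · have e1 : min (2 * r) (dist z q) = 2 * r := min_eq_left (by linarith)
        have e2 : min (2 * r) (dist (g z) q) = 2 * r := min_eq_left (by linarith)
        simp only [F, u, e1, e2]
        linarith
      · have h5 : μ ≤ ‖partials f z‖ := by
          refine hμf z fun q₁ hq₁ => ?_
          rcases eq_or_ne q₁ q with rfl | hne
          · exact hz
          · have := hsep i k q₁ hq₁ hne
            have h6 := dist_triangle q₁ z q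
            rw [dist_comm q₁ z] at h6
            linarith
        have h6 : u (g z) ≤ u z + dist (g z) z := by
          refine max_le ?_ ?_
          · linarith [le_max_left r (min (2 * r) (dist z q)), dist_nonneg (x := g z) (y := z)]
          · have := le_max_right r (min (2 * r) (dist z q))
            rcases min_choice (2 * r) (dist z q) with hm | hm
            · linarith [min_le_left (2 * r) (dist (g z) q), dist_nonneg (x := g z) (y := z)]
            · linarith [min_le_right (2 * r) (dist (g z) q)]
        have h7 := hgf z
        have h8 : μ * dist (g z) z ≤ ‖partials f z‖ * dist (g z) z := by gcongr
        have h9 : μ / 2 * u (g z) ≤ μ / 2 * (u z + dist (g z) z) := by gcongr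
        simp only [F]
        linarith
    have hFt (t : ℕ) : F (g^[t] y) ≤ F y := by
      induction t with
      | zero => exact le_rfl
      | succ t ih =>
        rw [Function.iterate_succ_apply']
        exact (hF _).trans ih
    have h1 := abs_lt.1 (hεf i k y hy)
    have h2 := abs_lt.1 (hεf i k' _ hy')
    have e1 : u y = r := max_eq_left ((min_le_right _ _).trans (by linarith))
    have e2 : 2 * r ≤ u (g^[t] y) := by
      refine le_max_of_le_right (le_min le_rfl ?_)
      have := dist_triangle q' (g^[t] y) q
      rw [dist_comm q' (g^[t] y)] at this
      linarith
    have h3 := hFt t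
    have h4 : μ / 2 * (2 * r) ≤ μ / 2 * u (g^[t] y) := by gcongr
    simp only [F, e1] at h3
    have : 0 < μ * r := by positivity
    linarith
  refine torus_cover_obstruction
    (fun i k => {x | ∃ t : ℕ, dist (g^[t] x) (p i + latticeVec k) < ε}) ?_ ?_ ?_ ?_
  · intro i k
    simp only [Set.ofPred_exists]
    exact isOpen_iUnion fun t => isOpen_lt ((hgc.iterate t).dist continuous_const) continuous_const
  · intro x
    by_contra! hx
    simp only [Set.mem_ofPred_eq, not_exists, not_lt] at hx
    obtain ⟨x₀, hx₀⟩ := exists_le_apply hf.continuous hper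
    have hdrop (t : ℕ) : f (g^[t] x) ≤ f x - t * (c / 2 * τ) := by
      induction t with
      | zero => simp
      | succ t ih =>
        rw [Function.iterate_succ_apply']
        set z := g^[t] x
        have h1 : c ≤ ‖partials f z‖ := hcf z fun q hq => by
          obtain ⟨i, k, rfl⟩ := hcrit q hq
          exact hx i k t
        have h2 : c / 2 * τ ≤ ‖partials f z‖ / 2 * dist (g z) z := by
          have := hgτ z (by linarith)
          gcongr
        have := hgf z
        push_cast
        linarith
    obtain ⟨t, ht⟩ := exists_nat_gt ((f x - f x₀) / (c / 2 * τ))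
    rw [div_lt_iff₀ (by positivity)] at ht
    linarith [hdrop t, hx₀ (g^[t] x)]
  · rintro i k m x ⟨t, ht⟩
    refine ⟨t, ?_⟩
    rwa [hiter, latticeVec_add, ← add_assoc, dist_add_right]
  · rintro i k k' x ⟨t, ht⟩ ⟨t', ht'⟩
    rcases le_total t t' with h | h
    · obtain ⟨s, rfl⟩ := Nat.exists_eq_add_of_le' h
      rw [Function.iterate_add_apply] at ht'
      exact horbit i k k' _ s ht ht'
    · obtain ⟨s, rfl⟩ := Nat.exists_eq_add_of_le' h
      rw [Function.iterate_add_apply] at ht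
      exact (horbit i k' k _ s ht' ht).symm

end Analysis

/-- A `C¹` function on `ℝ^n`, `2π`-periodic in each variable (i.e. a function
on the `n`-torus), has at least `n + 1` critical points that are pairwise distinct modulo
the lattice `(2πℤ)^n` (Ljusternik–Schnirelmann lower bound). -/
theorem torus_function_critical_points
    (n : ℕ) (f : (Fin n → ℝ) → ℝ)
    (hf : ContDiff ℝ 1 f)
    (hper : ∀ (x : Fin n → ℝ) (j : Fin n), f (x + Pi.single j (2 * Real.pi)) = f x) :
    ∃ p : Fin (n + 1) → (Fin n → ℝ),
      (∀ i, fderiv ℝ f (p i) = 0) ∧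
      (∀ i j, i ≠ j → ∀ k : Fin n → ℤ,
        p i ≠ p j + fun l => 2 * Real.pi * (k l : ℝ)) := by
  have hlat := apply_add_latticeVec hper
  obtain ⟨x₀, hx₀⟩ := exists_le_apply hf.continuous hlat
  have hcrit₀ : fderiv ℝ f x₀ = 0 := IsLocalMin.fderiv_eq_zero (Filter.Eventually.of_forall hx₀)
  suffices h : ∀ m ≤ n, ∃ p : Fin (m + 1) → (Fin n → ℝ), (∀ i, fderiv ℝ f (p i) = 0) ∧
      ∀ i j, i ≠ j → ∀ k, p i ≠ p j + latticeVec k from h n le_rfl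
  intro m
  induction m with
  | zero => exact fun _ => ⟨fun _ => x₀, fun _ => hcrit₀, fun i j hij =>
      absurd (Fin.ext (by omega)) hij⟩
  | succ m ih =>
    intro hm
    obtain ⟨p, hp, hne⟩ := ih (by omega)
    obtain ⟨q, hq, hqne⟩ := exists_fderiv_eq_zero_ne_add_latticeVec hf hlat
      (fun i : Fin n => p (Fin.ofNat (m + 1) i)) fun i => hp _
    have hqne' (j : Fin (m + 1)) (k) : q ≠ p j + latticeVec k := by
      have := hqne ⟨j, by omega⟩ k
      simpa using this
    refine ⟨Fin.cons q p, Fin.cases hq hp, fun i j => ?_⟩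
    refine Fin.cases (Fin.cases (fun h => absurd rfl h) (fun j _ k => ?_) j)
      (fun i => Fin.cases (fun _ k h => ?_) (fun j hij k => ?_) j) i
    · exact hqne' j k
    · refine hqne' i (-k) ?_
      simp only [Fin.cons_succ, Fin.cons_zero] at h
      rw [h, latticeVec_neg, add_neg_cancel_right]
    · exact hne i j (fun h => hij (congrArg _ h)) k
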